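/- arXiv:1606.06155 — 5 statements merged into one kernel-verified Lean document; each statement's English description precedes it below -/
import Mathlib

section
/- Let N ≥ 2 be an integer and let k be a positive integer. Then for every x ∈ ℝ^N \ {0} and every y ∈ ℝ^{N−1} \ {0}, |x|^{2k} · |∇_N^k v(x)|² = k! · Σ_{l=0}^{⌊k/2⌋} ((k−2l)!/(2l)!) · ( Σ_{n=⌈k/2⌉}^{k−l} 2^{2n−k} · ((−1)^n/(2n)) · C(n, k−n) · C(k−n, l) )² · |∇_{N−1}^{2l} p_l(y)|², where v(x) = log|x| on ℝ^N and p_l(y) = |y|^{2l} on ℝ^{N−1}. -/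
open scoped BigOperators

/-- The partial derivative `∂ᵢ` of a real-valued function on `ℝ^N`. -/
noncomputable def pd {N : ℕ} (i : Fin N) (u : EuclideanSpace ℝ (Fin N) → ℝ) :
    EuclideanSpace ℝ (Fin N) → ℝ :=
  fun x => fderiv ℝ u x (EuclideanSpace.single i 1)

/-- Iterated partial derivative `D_i = ∂_{i₁} ∂_{i₂} ⋯ ∂_{i_k}` for a list of indices. -/
noncomputable def pdIter {N : ℕ} (l : List (Fin N)) (u : EuclideanSpace ℝ (Fin N) → ℝ) :
    EuclideanSpace ℝ (Fin N) → ℝ :=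
  l.foldr pd u

/-- `|∇_N^k u(x)|² = Σ_{i ∈ {1,…,N}^k} (D_i u(x))²`. -/
noncomputable def gradSq (N k : ℕ) (u : EuclideanSpace ℝ (Fin N) → ℝ)
    (x : EuclideanSpace ℝ (Fin N)) : ℝ :=
  ∑ i : Fin k → Fin N, (pdIter (List.ofFn i) u x) ^ 2

/-- The falling factorial `(ν)_k = ν(ν−1)⋯(ν−k+1)`. -/
noncomputable def ffac (ν : ℝ) (k : ℕ) : ℝ := ∏ j ∈ Finset.range k, (ν - j)

/-- The generalized binomial coefficient `C(ν,k) = (ν)_k / k!`. -/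
noncomputable def gchoose (ν : ℝ) (k : ℕ) : ℝ := ffac ν k / (Nat.factorial k)

noncomputable def lucW : ℕ → ℕ → ℝ
  | 0, 0 => 2
  | 0, _ + 1 => 0
  | 1, 0 => 1
  | 1, _ + 1 => 0
  | _ + 2, 0 => 1
  | k + 2, j + 1 => lucW (k + 1) (j + 1) + lucW k j

lemma lucW_zero_of (k : ℕ) : ∀ j, k < 2 * j → lucW k j = 0 := by
  induction k using Nat.strong_induction_on with
  | _ k ih =>
    intro j hj
    match k, j with
    | 0, j + 1 => simp [lucW]
    | 1, j + 1 => simp [lucW]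
    | k + 2, j + 1 =>
      rw [lucW, ih (k + 1) (by omega) (j + 1) (by omega), ih k (by omega) j (by omega)]; simp

lemma lucW_formula (k : ℕ) : ∀ j n, 0 < k → k = n + j → (n : ℝ) * lucW k j = k * (n.choose j : ℝ) := by
  induction k using Nat.strong_induction_on with
  | _ k ih =>
    intro j n hk hn
    match k, j with
    | 1, 0 => simp [lucW]; omega
    | 1, j + 1 =>
      have : n = 0 := by omega
      subst this
      simp
    | k + 2, 0 => simp [lucW]; subst hn; simp
    | k + 2, j + 1 =>
      rw [lucW]
      rcases n with _ | n
      · simp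
      rcases Nat.eq_zero_or_pos k with h0 | h0
      · subst h0
        have hj : j = 0 := by omega
        have hn' : n = 0 := by omega
        subst hj; subst hn'
        simp [lucW]
      have hk' : k = n + j := by omega
      rcases n with _ | n
      · have hkj : k = j := by omega
        subst hkj
        rw [lucW_zero_of (k+1) (k+1) (by omega), lucW_zero_of k k (by omega)]
        rw [Nat.choose_eq_zero_of_lt (by omega)]; simp
      have h1 := ih (k + 1) (by omega) (j + 1) (n + 1) (by omega) (by omega)
      have h2 := ih k (by omega) j (n + 1) h0 (by omega)
      have e1 : ((n + 1).choose (j + 1) : ℝ) * (j + 1) = ((n + 1).choose j : ℝ) * (n + 1 - j) := by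
        rcases le_or_gt j (n + 1) with h | h
        · have := Nat.choose_succ_right_eq (n + 1) j
          have h3 : (((n + 1).choose (j + 1) * (j + 1) : ℕ) : ℝ) = (((n + 1).choose j * (n + 1 - j) : ℕ) : ℝ) := by
            rw [this]
          push_cast [Nat.cast_sub h] at h3
          exact h3
        · rw [Nat.choose_eq_zero_of_lt (by omega), Nat.choose_eq_zero_of_lt h]; simp
      have e2 : ((n + 1 + 1).choose (j + 1) : ℝ) = (n+1).choose j + (n + 1).choose (j + 1) := by
        rw [Nat.choose_succ_succ]; push_cast; ring
      rw [e2]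
      have hkr : (k : ℝ) = n + 1 + j := by rw [hk']; push_cast; ring
      push_cast at h1 h2 ⊢
      rw [hkr] at h1 h2 ⊢
      have hn1 : (n : ℝ) + 1 ≠ 0 := by positivity
      have hj1 : (j : ℝ) + 1 ≠ 0 := by positivity
      apply mul_left_cancel₀ hn1
      have : ((n:ℝ) + 1) * ((n + 1 + 1) * (lucW (k + 1) (j + 1) + lucW k j)) =
        (n + 1 + 1) * (((n:ℝ) + 1) * lucW (k + 1) (j + 1) + (n + 1) * lucW k j) := by ring
      rw [this, h1, h2]
      linear_combination e1

noncomputable def lucB (k l : ℕ) : ℝ :=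
  ∑ j ∈ Finset.range (k + 1), lucW k j * 2 ^ k * (-1 / 4) ^ j * (j.choose l : ℝ)

lemma lucB_ext (k l K : ℕ) (h : k ≤ K) : lucB k l =
    ∑ j ∈ Finset.range (K + 1), lucW k j * 2 ^ k * (-1 / 4) ^ j * (j.choose l : ℝ) := by
  unfold lucB
  apply Finset.sum_subset
  · intro a; simp; omega
  · intro a _ h2
    rw [lucW_zero_of k a (by simp at h2; omega)]; simp

lemma lucW_succ_zero (k : ℕ) : lucW (k + 1) 0 = 1 := by
  cases k <;> simp [lucW]

lemma lucB_rec (k l : ℕ) : lucB (k + 2) l = 2 * lucB (k + 1) l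
    - ∑ j ∈ Finset.range (k + 2), lucW k j * 2 ^ k * (-1 / 4) ^ j * ((j + 1).choose l : ℝ) := by
  rw [lucB_ext (k + 1) l (k + 2) (by omega)]
  unfold lucB
  rw [Finset.sum_range_succ', Finset.sum_range_succ' _ (k + 2), mul_add, Finset.mul_sum]
  rw [lucW_succ_zero, lucW_succ_zero k]
  rw [add_sub_right_comm, ← Finset.sum_sub_distrib]
  congr 1
  · apply Finset.sum_congr rfl
    intro j _
    rw [lucW]; ring
  · ring

lemma lucB_eq (k : ℕ) : ∀ l, lucB k l = 2 * (-1) ^ l * (k.choose (2 * l) : ℝ) := by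
  induction k using Nat.strong_induction_on with
  | _ k ih =>
    intro l
    match k with
    | 0 => cases l <;> simp [lucB, lucW, Nat.choose_eq_zero_of_lt]
    | 1 =>
      rcases l with _ | l
      · simp [lucB, Finset.sum_range_succ, lucW]
      · rw [Nat.choose_eq_zero_of_lt (by omega)]
        simp [lucB, Finset.sum_range_succ, lucW]
    | k + 2 =>
      rw [lucB_rec, ih (k + 1) (by omega)]
      rcases l with _ | l
      · have := lucB_ext k 0 (k + 1) (by omega)
        simp only [Nat.choose_zero_right] at this ⊢
        rw [← this, ih k (by omega)]
        simp; ring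
      · have h1 := lucB_ext k (l + 1) (k + 1) (by omega)
        have h2 := lucB_ext k l (k + 1) (by omega)
        have : ∑ j ∈ Finset.range (k + 2), lucW k j * 2 ^ k * (-1 / 4) ^ j * ((j + 1).choose (l + 1) : ℝ)
          = lucB k l + lucB k (l + 1) := by
          rw [h1, h2, ← Finset.sum_add_distrib]
          apply Finset.sum_congr rfl
          intro j _
          rw [Nat.choose_succ_succ]; push_cast; ring
        rw [this, ih k (by omega), ih k (by omega)]
        have e : 2 * (l + 1) = 2 * l + 1 + 1 := by ring
        rw [e, Nat.choose_succ_succ (k + 1), Nat.choose_succ_succ k, Nat.choose_succ_succ k]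
        push_cast; ring

lemma gchoose_nat (n k : ℕ) : gchoose n k = n.choose k := by
  unfold gchoose ffac
  rw [Nat.choose_eq_descFactorial_div_factorial, Nat.cast_div (Nat.factorial_dvd_descFactorial n k) (by positivity)]
  congr 1
  induction k with
  | zero => simp
  | succ k ih =>
    rw [Finset.prod_range_succ, ih, Nat.descFactorial_succ]
    rcases le_or_gt k n with h | h
    · push_cast [Nat.cast_sub h]; ring
    · rw [Nat.descFactorial_eq_zero_iff_lt.2 h]; simp

lemma coef_sum (k l : ℕ) (hk : 0 < k) :
    (∑ n ∈ Finset.Icc ((k + 1) / 2) (k - l),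
      (2 : ℝ) ^ (2 * n - k) * ((-1 : ℝ) ^ n / (2 * n)) * gchoose (n : ℝ) (k - n) *
        gchoose ((k - n : ℕ) : ℝ) l) = (-1) ^ (k + l) * (k.choose (2 * l) : ℝ) / k := by
  have hk' : (k : ℝ) ≠ 0 := by positivity
  have : (-1) ^ (k + l) * (k.choose (2 * l) : ℝ) / k = (-1) ^ k / (2 * k) * lucB k l := by
    rw [lucB_eq]; field_simp; ring
  rw [this, lucB, Finset.mul_sum, ← Finset.sum_range_reflect]
  symm
  have hsub : Finset.Icc ((k + 1) / 2) (k - l) ⊆ Finset.range (k + 1) := by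
    intro a; simp; omega
  refine (Finset.sum_subset_zero_on_sdiff hsub ?_ ?_).symm
  · intro n hn
    simp only [Finset.mem_sdiff, Finset.mem_range, Finset.mem_Icc, not_and_or, not_le] at hn
    obtain ⟨h1, h2⟩ := hn
    have e : k + 1 - 1 - n = k - n := by omega
    rw [e]
    rcases h2 with h2 | h2
    · rw [lucW_zero_of k (k - n) (by omega)]; simp
    · rw [Nat.choose_eq_zero_of_lt (by omega : k - n < l)]; simp
  · intro n hn
    simp only [Finset.mem_Icc] at hn
    have e : k + 1 - 1 - n = k - n := by omega
    rw [e, gchoose_nat, gchoose_nat]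
    have hn0 : (n : ℝ) ≠ 0 := by
      have : 0 < n := by omega
      positivity
    have h := lucW_formula k (k - n) n hk (by omega)
    have h' : lucW k (k - n) = k * (n.choose (k - n) : ℝ) / n := by
      field_simp; linarith
    rw [h']
    obtain ⟨j, rfl⟩ : ∃ j, k = n + j := ⟨k - n, by omega⟩
    obtain ⟨m, rfl⟩ : ∃ m, n = j + m := ⟨n - j, by omega⟩
    have e1 : j + m + j - (j + m) = j := by omega
    have e2 : 2 * (j + m) - (j + m + j) = m := by omega
    rw [e1, e2]
    have e3 : (2 : ℝ) ^ (j + m + j) = 2 ^ m * 4 ^ j := by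
      rw [show (4 : ℝ) = 2 ^ 2 by norm_num, ← pow_mul, ← pow_add]; congr 1; ring
    rw [e3, div_pow]
    have e4 : (-1 : ℝ) ^ (j + m + j) = (-1) ^ (j + m) * (-1) ^ j := pow_add _ _ _
    have e5 : (-1 : ℝ) ^ j * (-1) ^ j = 1 := by rw [← mul_pow]; simp
    rw [e4]
    field_simp
    linear_combination (-((j + m).choose j : ℝ) * (j.choose l : ℝ)) * e5

open scoped ContDiff

lemma pd_smooth {N : ℕ} {U : Set (EuclideanSpace ℝ (Fin N))} (hU : IsOpen U)
    {u : EuclideanSpace ℝ (Fin N) → ℝ} (hu : ContDiffOn ℝ ∞ u U) (i : Fin N) :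
    ContDiffOn ℝ ∞ (pd i u) U := by
  unfold pd
  exact (hu.fderiv_of_isOpen hU (by simp)).clm_apply contDiffOn_const

lemma pdIter_cons {N : ℕ} (i : Fin N) (l : List (Fin N)) (u : EuclideanSpace ℝ (Fin N) → ℝ) :
    pdIter (i :: l) u = pd i (pdIter l u) := rfl

lemma pdIter_smooth {N : ℕ} {U : Set (EuclideanSpace ℝ (Fin N))} (hU : IsOpen U)
    {u : EuclideanSpace ℝ (Fin N) → ℝ} (hu : ContDiffOn ℝ ∞ u U) (l : List (Fin N)) :
    ContDiffOn ℝ ∞ (pdIter l u) U := by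
  induction l with
  | nil => exact hu
  | cons i l ih => exact pd_smooth hU ih i

lemma pd_congr {N : ℕ} {U : Set (EuclideanSpace ℝ (Fin N))} (hU : IsOpen U)
    {u w : EuclideanSpace ℝ (Fin N) → ℝ} (h : Set.EqOn u w U) (i : Fin N) :
    Set.EqOn (pd i u) (pd i w) U := by
  intro x hx
  unfold pd
  rw [Filter.EventuallyEq.fderiv_eq (h.eventuallyEq_of_mem (hU.mem_nhds hx))]

lemma pd_pd {N : ℕ} {U : Set (EuclideanSpace ℝ (Fin N))} (hU : IsOpen U)
    {u : EuclideanSpace ℝ (Fin N) → ℝ} (hu : ContDiffOn ℝ ∞ u U) (i j : Fin N)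
    {x : EuclideanSpace ℝ (Fin N)} (hx : x ∈ U) :
    pd i (pd j u) x = fderiv ℝ (fderiv ℝ u) x (EuclideanSpace.single i 1)
      (EuclideanSpace.single j 1) := by
  have h1 : ContDiffOn ℝ ∞ (fderiv ℝ u) U := hu.fderiv_of_isOpen hU (by simp)
  have h2 : DifferentiableAt ℝ (fderiv ℝ u) x :=
    ((h1.contDiffAt (hU.mem_nhds hx)).differentiableAt (by simp))
  unfold pd
  rw [fderiv_clm_apply h2 (differentiableAt_const _)]
  simp

lemma pdIter_perm {N : ℕ} {U : Set (EuclideanSpace ℝ (Fin N))} (hU : IsOpen U)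
    {u : EuclideanSpace ℝ (Fin N) → ℝ} (hu : ContDiffOn ℝ ∞ u U) {l l' : List (Fin N)}
    (h : l.Perm l') : Set.EqOn (pdIter l u) (pdIter l' u) U := by
  induction h with
  | nil => exact fun _ _ => rfl
  | cons i _ ih => exact pd_congr hU ih i
  | swap i j l =>
    intro x hx
    have h1 := pdIter_smooth hU hu l
    simp only [pdIter_cons]
    rw [pd_pd hU h1 _ _ hx, pd_pd hU h1 _ _ hx]
    exact ((h1.contDiffAt (hU.mem_nhds hx)).isSymmSndFDerivAt
      (by simp only [minSmoothness_of_isRCLikeNormedField]; exact WithTop.coe_le_coe.2 (le_top : (2 : ℕ∞) ≤ ⊤))).eq _ _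
  | trans _ _ ih1 ih2 => exact ih1.trans ih2

lemma pdIter_eq_iteratedFDeriv {N : ℕ} {U : Set (EuclideanSpace ℝ (Fin N))} (hU : IsOpen U)
    {u : EuclideanSpace ℝ (Fin N) → ℝ} (hu : ContDiffOn ℝ ∞ u U) (k : ℕ) :
    ∀ (i : Fin k → Fin N), ∀ x ∈ U, pdIter (List.ofFn i) u x =
      iteratedFDeriv ℝ k u x (fun j => EuclideanSpace.single (i j) 1) := by
  induction k with
  | zero => intro i x hx; simp [pdIter]
  | succ k ih =>
    intro i x hx
    rw [List.ofFn_succ, pdIter_cons, iteratedFDeriv_succ_apply_left]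
    have h1 : Set.EqOn (pdIter (List.ofFn fun j => i j.succ) u)
      (fun x => iteratedFDeriv ℝ k u x (fun j => EuclideanSpace.single (i j.succ) 1)) U :=
      fun x hx => ih _ x hx
    rw [pd_congr hU h1 _ hx]
    unfold pd
    have h2 : DifferentiableAt ℝ (iteratedFDeriv ℝ k u) x :=
      (hu.contDiffAt (hU.mem_nhds hx)).differentiableAt_iteratedFDeriv
        (by exact_mod_cast ENat.natCast_lt_top k)
    have h3 := (h2.hasFDerivAt.continuousMultilinear_apply_const
      (fun j => EuclideanSpace.single (i j.succ) (1 : ℝ))).fderiv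
    rw [h3]
    rfl

/-- basis independence of the Hilbert-Schmidt norm of a multilinear map -/
lemma hs_indep {E : Type*} [NormedAddCommGroup E] [InnerProductSpace ℝ E] {N : ℕ}
    (b b' : OrthonormalBasis (Fin N) ℝ E) (k : ℕ) :
    ∀ (f : MultilinearMap ℝ (fun _ : Fin k => E) ℝ),
    ∑ i : Fin k → Fin N, (f fun j => b (i j)) ^ 2 = ∑ i : Fin k → Fin N, (f fun j => b' (i j)) ^ 2 := by
  have : FiniteDimensional ℝ E := b.toBasis.finiteDimensional_of_finite
  have key : ∀ φ : E →ₗ[ℝ] ℝ, ∑ i, (φ (b i)) ^ 2 = ∑ i, (φ (b' i)) ^ 2 := by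
    intro φ
    have h : ∀ c : OrthonormalBasis (Fin N) ℝ E, ∑ i, (φ (c i)) ^ 2 =
        ‖(InnerProductSpace.toDual ℝ E).symm (LinearMap.toContinuousLinearMap φ)‖ ^ 2 := by
      intro c
      rw [← c.sum_sq_norm_inner_left]
      apply Finset.sum_congr rfl
      intro i _
      rw [InnerProductSpace.toDual_symm_apply]
      simp
    rw [h b, h b']
  induction k with
  | zero => intro f; rw [Fintype.sum_unique, Fintype.sum_unique]; congr 2; ext j; exact j.elim0
  | succ k ih =>
    intro f
    rw [← (Fin.consEquiv fun _ => Fin N).sum_comp, ← (Fin.consEquiv fun _ => Fin N).sum_comp]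
    rw [Fintype.sum_prod_type, Fintype.sum_prod_type]
    have e : ∀ (c d : OrthonormalBasis (Fin N) ℝ E) (i : Fin N) (g : Fin k → Fin N),
      f.curryLeft (c i) (fun j => d (g j)) = f (Fin.cons (c i) (fun j => d (g j))) := by
      intros; rfl
    have e' : ∀ (c : OrthonormalBasis (Fin N) ℝ E) (i : Fin N) (g : Fin k → Fin N),
      (fun j => c ((Fin.consEquiv fun _ => Fin N) (i, g) j)) =
        (Fin.cons (c i) (fun j => c (g j)) : Fin (k + 1) → E) := by
      intro c i g
      ext j
      refine Fin.cases ?_ (fun j => ?_) j <;> simp [Fin.consEquiv]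
    simp only [e', ← e]
    have h1 : ∀ i, ∑ g : Fin k → Fin N, (f.curryLeft (b i) fun j => b (g j)) ^ 2 =
      ∑ g : Fin k → Fin N, (f.curryLeft (b i) fun j => b' (g j)) ^ 2 := fun i => ih _
    simp only [h1]
    rw [Finset.sum_comm, Finset.sum_comm (s := (Finset.univ : Finset (Fin N)))]
    apply Finset.sum_congr rfl
    intro g _
    let φ : E →ₗ[ℝ] ℝ :=
      { toFun := fun v => f.curryLeft v (fun j => b' (g j))
        map_add' := by intro v w; simp only [map_add, add_apply]
        map_smul' := by intro c v; simp only [map_smul, smul_apply]; rfl }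
    exact key φ

lemma gradSq_rot {N : ℕ} (k : ℕ) {u : EuclideanSpace ℝ (Fin N) → ℝ}
    (hu : ContDiffOn ℝ ∞ u {0}ᶜ)
    (A : EuclideanSpace ℝ (Fin N) ≃ₗᵢ[ℝ] EuclideanSpace ℝ (Fin N)) (hA : ∀ z, u (A z) = u z)
    (x : EuclideanSpace ℝ (Fin N)) (hx : x ≠ 0) : gradSq N k u (A x) = gradSq N k u x := by
  have hU : IsOpen ({0}ᶜ : Set (EuclideanSpace ℝ (Fin N))) := isOpen_compl_singleton
  have hAx : A x ≠ 0 := by simpa using hx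
  unfold gradSq
  simp only [pdIter_eq_iteratedFDeriv hU hu k _ _ hx, pdIter_eq_iteratedFDeriv hU hu k _ _ hAx]
  let b := EuclideanSpace.basisFun (Fin N) ℝ
  have h := hs_indep b (b.map A) k (iteratedFDeriv ℝ k u (A x)).toMultilinearMap
  have hb : ∀ i, b i = EuclideanSpace.single i 1 := fun i => by simp [b]
  have e : iteratedFDeriv ℝ k u x = (iteratedFDeriv ℝ k u (A x)).compContinuousLinearMap
      (fun _ => (A.toContinuousLinearEquiv : EuclideanSpace ℝ (Fin N) →L[ℝ] EuclideanSpace ℝ (Fin N))) := by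
    have h1 := A.toContinuousLinearEquiv.iteratedFDerivWithin_comp_right u (s := Set.univ)
      uniqueDiffOn_univ (x := x) (Set.mem_univ _) k
    simp only [Set.preimage_univ, iteratedFDerivWithin_univ] at h1
    have h2 : u ∘ A.toContinuousLinearEquiv = u := by ext z; exact hA z
    rw [h2] at h1
    exact h1
  rw [e]
  simpa [hb] using h

lemma exists_rot {N : ℕ} [NeZero N] (x : EuclideanSpace ℝ (Fin N)) (hx : x ≠ 0) :
    ∃ A : EuclideanSpace ℝ (Fin N) ≃ₗᵢ[ℝ] EuclideanSpace ℝ (Fin N),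
      A (‖x‖ • EuclideanSpace.single 0 1) = x := by
  have hn : ‖x‖ ≠ 0 := by simpa using hx
  have ho : Orthonormal ℝ (({0} : Set (Fin N)).domRestrict (fun _ => ‖x‖⁻¹ • x)) := by
    rw [orthonormal_iff_ite]
    rintro ⟨i, hi⟩ ⟨j, hj⟩
    simp only [Set.mem_singleton_iff] at hi hj
    subst hi; subst hj
    simp [Set.domRestrict, norm_smul, hn]
  obtain ⟨b, hb⟩ := ho.exists_orthonormalBasis_extension_of_card_eq (by simp)
  refine ⟨b.repr.symm, ?_⟩
  rw [map_smul, OrthonormalBasis.repr_symm_single, hb 0 (by simp), smul_smul, mul_inv_cancel₀ hn, one_smul]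

lemma perm_decomp {M : ℕ} (k : ℕ) : ∀ T : List (Fin (M + 1)) → ℝ,
    (∀ l l', l.Perm l' → T l = T l') →
    ∑ i : Fin k → Fin (M + 1), (T (List.ofFn i)) ^ 2 =
      ∑ p ∈ Finset.HasAntidiagonal.antidiagonal k, (k.choose p.1 : ℝ) *
        ∑ j : Fin p.2 → Fin M, (T (List.replicate p.1 0 ++ (List.ofFn j).map Fin.succ)) ^ 2 := by
  induction k with
  | zero => intro T hT; simp
  | succ k ih =>
    intro T hT
    rw [← (Fin.consEquiv fun _ => Fin (M + 1)).sum_comp, Fintype.sum_prod_type]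
    have e : ∀ {n : ℕ} (a : Fin n) (g : Fin k → Fin n),
        List.ofFn ((Fin.consEquiv fun _ => Fin n) (a, g)) = a :: List.ofFn g := by
      intro n a g
      rw [List.ofFn_succ]; simp [Fin.consEquiv]
    simp only [e]
    have hT' : ∀ a, ∀ l l', l.Perm l' → T (a :: l) = T (a :: l') :=
      fun a l l' h => hT _ _ (h.cons a)
    have h1 : ∀ a, _ := fun a => ih (fun l => T (a :: l)) (hT' a)
    simp only [h1]
    rw [Fin.sum_univ_succ]
    have := Finset.sum_antidiagonal_choose_succ_mul (R := ℝ) (fun m b =>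
      ∑ j : Fin b → Fin M, (T (List.replicate m 0 ++ (List.ofFn j).map Fin.succ)) ^ 2) k
    rw [this, add_comm]
    congr 1
    · rw [Finset.sum_comm]
      apply Finset.sum_congr rfl
      rintro ⟨m, b⟩ _
      rw [← Finset.mul_sum]
      congr 1
      simp only
      rw [← (Fin.consEquiv fun _ => Fin M).sum_comp, Fintype.sum_prod_type]
      apply Finset.sum_congr rfl
      intro a _
      apply Finset.sum_congr rfl
      intro g _
      congr 1
      apply hT
      have e2 : List.ofFn ((Fin.consEquiv fun _ => Fin M) (a, g)) = a :: List.ofFn g := by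
        rw [List.ofFn_succ]; simp [Fin.consEquiv]
      rw [e2, List.map_cons]
      exact List.perm_middle.symm
    · apply Finset.sum_congr rfl
      rintro ⟨m, b⟩ hmb
      simp only [Finset.HasAntidiagonal.mem_antidiagonal] at hmb
      simp only
      rw [Nat.choose_symm_of_eq_add (by omega : k = m + b)]
      rfl

/-- universal polynomials in the derivatives of radial functions -/
noncomputable def radQ {M : ℕ} : List (Fin M) → ℕ → EuclideanSpace ℝ (Fin M) → ℝ
  | [], 0 => fun _ => 1
  | [], _ + 1 => fun _ => 0
  | j :: J, 0 => pd j (radQ J 0)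
  | j :: J, p + 1 => fun y => pd j (radQ J (p + 1)) y + 2 * y j * radQ J p y

lemma radQ_smooth {M : ℕ} (J : List (Fin M)) : ∀ p, ContDiffOn ℝ ∞ (radQ J p) Set.univ := by
  induction J with
  | nil => intro p; cases p <;> exact contDiffOn_const
  | cons j J ih =>
    intro p
    cases p with
    | zero => exact pd_smooth isOpen_univ (ih 0) j
    | succ p =>
      refine (pd_smooth isOpen_univ (ih (p + 1)) j).add ((ContDiffOn.mul ?_ (ih p)))
      have : ContDiff ℝ ∞ (fun y : EuclideanSpace ℝ (Fin M) => 2 * y j) := by fun_prop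
      exact this.contDiffOn

lemma radQ_zero {M : ℕ} (J : List (Fin M)) : ∀ p, J.length < p → radQ J p = fun _ => 0 := by
  induction J with
  | nil => intro p hp; cases p with
    | zero => simp at hp
    | succ p => rfl
  | cons j J ih =>
    intro p hp
    cases p with
    | zero => simp at hp
    | succ p =>
      simp only [List.length_cons] at hp
      funext y
      simp only [radQ]
      rw [ih (p + 1) (by omega), ih p (by omega)]
      simp [pd]

lemma pd_radial {M : ℕ} (g : ℝ → ℝ) (g' : ℝ) (y : EuclideanSpace ℝ (Fin M))
    (h : HasDerivAt g g' (‖y‖ ^ 2)) :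
    HasFDerivAt (fun y : EuclideanSpace ℝ (Fin M) => g (‖y‖ ^ 2)) (g' • (2 • innerSL ℝ y)) y := by
  have h1 : HasFDerivAt (fun y : EuclideanSpace ℝ (Fin M) => ‖y‖ ^ 2) (2 • innerSL ℝ y) y :=
    (hasStrictFDerivAt_norm_sq y).hasFDerivAt
  exact h.comp_hasFDerivAt y h1

lemma radial_deriv {M : ℕ} (G : ℕ → ℝ → ℝ)
    (hG : ∀ p s, 0 ≤ s → HasDerivAt (G p) (G (p + 1) s) s) (J : List (Fin M)) :
    pdIter J (fun y => G 0 (‖y‖ ^ 2)) =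
      fun y => ∑ p ∈ Finset.range (J.length + 1), G p (‖y‖ ^ 2) * radQ J p y := by
  induction J with
  | nil => funext y; simp [pdIter, radQ]
  | cons j J ih =>
    rw [pdIter_cons, ih]
    funext y
    have hQ : ∀ p, HasFDerivAt (radQ J p) (fderiv ℝ (radQ J p) y) y := fun p =>
      (((radQ_smooth J p).contDiffAt Filter.univ_mem).differentiableAt (by simp)).hasFDerivAt
    have hF : HasFDerivAt (fun y => ∑ p ∈ Finset.range (J.length + 1), G p (‖y‖ ^ 2) * radQ J p y)
        (∑ p ∈ Finset.range (J.length + 1), (G p (‖y‖ ^ 2) • fderiv ℝ (radQ J p) y +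
          radQ J p y • (G (p + 1) (‖y‖ ^ 2) • (2 • innerSL ℝ y)))) y := by
      apply HasFDerivAt.fun_sum
      intro p _
      exact (pd_radial (G p) _ y (hG p _ (by positivity))).mul (hQ p)
    unfold pd
    rw [hF.fderiv, List.length_cons, Finset.sum_range_succ' _ (J.length + 1)]
    have hz : G (J.length + 1) (‖y‖ ^ 2) * pd j (radQ J (J.length + 1)) y = 0 := by
      rw [radQ_zero J _ (by omega)]; simp [pd]
    have hs : ∑ p ∈ Finset.range (J.length + 1), G (p + 1) (‖y‖ ^ 2) * pd j (radQ J (p + 1)) y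
        + G 0 (‖y‖ ^ 2) * pd j (radQ J 0) y
        = ∑ p ∈ Finset.range (J.length + 1), G p (‖y‖ ^ 2) * pd j (radQ J p) y := by
      rw [← Finset.sum_range_succ' (fun p => G p (‖y‖ ^ 2) * pd j (radQ J p) y),
        Finset.sum_range_succ, hz, add_zero]
    have hr : ∑ p ∈ Finset.range (J.length + 1), G (p + 1) (‖y‖ ^ 2) * radQ (j :: J) (p + 1) y =
        ∑ p ∈ Finset.range (J.length + 1), G (p + 1) (‖y‖ ^ 2) * pd j (radQ J (p + 1)) y +
        ∑ p ∈ Finset.range (J.length + 1), G (p + 1) (‖y‖ ^ 2) * (2 * y j * radQ J p y) := by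
      rw [← Finset.sum_add_distrib]
      apply Finset.sum_congr rfl
      intro p _
      simp only [radQ]; ring
    have hr0 : radQ (j :: J) 0 y = pd j (radQ J 0) y := rfl
    rw [hr, hr0, add_right_comm, hs, ← Finset.sum_add_distrib]
    rw [sum_apply]
    apply Finset.sum_congr rfl
    intro p _
    simp [pd, EuclideanSpace.inner_single_right]
    ring

lemma homog_deriv {M : ℕ} (f : EuclideanSpace ℝ (Fin M) → ℝ) (d : ℕ)
    (hd : ∀ (c : ℝ) y, f (c • y) = c ^ d * f y) (hf : ContDiffOn ℝ ∞ f Set.univ)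
    (J : List (Fin M)) (c : ℝ) :
    ∀ y, c ^ J.length * pdIter J f (c • y) = c ^ d * pdIter J f y := by
  induction J with
  | nil => intro y; simpa [pdIter] using hd c y
  | cons j J ih =>
    intro y
    have hg : Differentiable ℝ (pdIter J f) := fun y =>
      (((pdIter_smooth isOpen_univ hf J).contDiffAt Filter.univ_mem).differentiableAt (by simp))
    have h1 : HasFDerivAt (fun y => c ^ J.length * pdIter J f (c • y))
        (c ^ J.length • ((fderiv ℝ (pdIter J f) (c • y)).comp
          (c • ContinuousLinearMap.id ℝ (EuclideanSpace ℝ (Fin M))))) y := by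
      have h2 : HasFDerivAt (fun y : EuclideanSpace ℝ (Fin M) => c • y)
        (c • ContinuousLinearMap.id ℝ (EuclideanSpace ℝ (Fin M))) y := (hasFDerivAt_id y).const_smul c
      exact (((hg (c • y)).hasFDerivAt).comp y h2).const_mul (c ^ J.length)
    have h3 : HasFDerivAt (fun y => c ^ d * pdIter J f y) (c ^ d • fderiv ℝ (pdIter J f) y) y :=
      ((hg y).hasFDerivAt).const_mul _
    rw [funext ih] at h1
    have h4 := congrArg (fun φ => φ (EuclideanSpace.single j (1 : ℝ))) (h1.unique h3)
    simp only [pdIter_cons, pd, List.length_cons]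
    simp at h4
    rw [← h4]; ring

lemma normpow_smooth {M : ℕ} (l : ℕ) :
    ContDiffOn ℝ ∞ (fun z : EuclideanSpace ℝ (Fin M) => ‖z‖ ^ (2 * l)) Set.univ := by
  have : (fun z : EuclideanSpace ℝ (Fin M) => ‖z‖ ^ (2 * l)) = fun z => (‖z‖ ^ 2) ^ l := by
    funext z; rw [pow_mul]
  rw [this]
  exact ((contDiff_norm_sq ℝ).pow l).contDiffOn

lemma normpow_homog {M : ℕ} (l : ℕ) (c : ℝ) (y : EuclideanSpace ℝ (Fin M)) :
    ‖c • y‖ ^ (2 * l) = c ^ (2 * l) * ‖y‖ ^ (2 * l) := by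
  rw [norm_smul, mul_pow]; congr 1; rw [pow_mul, pow_mul]; simp

lemma normpow_zero {M : ℕ} (l : ℕ) (J : List (Fin M)) (h : J.length ≠ 2 * l) :
    pdIter J (fun z : EuclideanSpace ℝ (Fin M) => ‖z‖ ^ (2 * l)) 0 = 0 := by
  have := homog_deriv _ (2 * l) (normpow_homog l) (normpow_smooth l) J 2 0
  rw [smul_zero] at this
  have h2 : (2 : ℝ) ^ J.length ≠ 2 ^ (2 * l) := by
    intro h'
    exact h (pow_right_injective₀ (by norm_num) (by norm_num) h')
  by_contra h3
  exact h2 (mul_right_cancel₀ h3 this)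

lemma normpow_const {M : ℕ} (l : ℕ) (J : List (Fin M)) (h : J.length = 2 * l)
    (y : EuclideanSpace ℝ (Fin M)) :
    pdIter J (fun z : EuclideanSpace ℝ (Fin M) => ‖z‖ ^ (2 * l)) 0 =
    pdIter J (fun z : EuclideanSpace ℝ (Fin M) => ‖z‖ ^ (2 * l)) y := by
  have hh := fun c => homog_deriv _ (2 * l) (normpow_homog l) (normpow_smooth l) J c y
  have hc : Continuous (pdIter J (fun z : EuclideanSpace ℝ (Fin M) => ‖z‖ ^ (2 * l))) :=
    continuousOn_univ.1 (pdIter_smooth isOpen_univ (normpow_smooth l) J).continuousOn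
  set g := pdIter J (fun z : EuclideanSpace ℝ (Fin M) => ‖z‖ ^ (2 * l))
  have h1 : Filter.Tendsto (fun c : ℝ => g (c • y)) (nhdsWithin 0 {0}ᶜ) (nhds (g ((0 : ℝ) • y))) :=
    ((hc.comp (continuous_id.smul continuous_const)).tendsto (0 : ℝ)).mono_left nhdsWithin_le_nhds
  have h2 : Filter.Tendsto (fun c : ℝ => g (c • y)) (nhdsWithin 0 {0}ᶜ) (nhds (g y)) := by
    refine tendsto_const_nhds.congr' ?_
    filter_upwards [self_mem_nhdsWithin] with c hc
    have := hh c
    rw [h] at this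
    exact (mul_left_cancel₀ (pow_ne_zero _ hc) this).symm
  have := tendsto_nhds_unique h1 h2
  rwa [zero_smul] at this

lemma radQ_at_zero {M : ℕ} (J : List (Fin M)) (l : ℕ) (hl : l ≤ J.length) :
    pdIter J (fun z : EuclideanSpace ℝ (Fin M) => ‖z‖ ^ (2 * l)) 0 = (l.factorial : ℝ) * radQ J l 0 := by
  have h := radial_deriv (M := M) (fun p s => (l.descFactorial p : ℝ) * s ^ (l - p)) (by
    intro p s _
    have := (hasDerivAt_pow (l - p) s).const_mul (l.descFactorial p : ℝ)
    convert! this using 1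
    rw [Nat.descFactorial_succ, ← Nat.sub_sub]; push_cast; ring) J
  simp only [Nat.descFactorial_zero, Nat.cast_one, one_mul, Nat.sub_zero, ← pow_mul] at h
  rw [h]
  simp only
  rw [Finset.sum_eq_single l]
  · simp [Nat.descFactorial_self]
  · intro p hp hpl
    rcases lt_or_gt_of_ne hpl with h1 | h1
    · have : 2 * (l - p) ≠ 0 := by omega
      simp [this]
    · rw [Nat.descFactorial_eq_zero_iff_lt.2 h1]; simp
  · intro h'; simp at h'; omega

lemma radial_at_zero {M : ℕ} (G : ℕ → ℝ → ℝ)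
    (hG : ∀ p s, 0 ≤ s → HasDerivAt (G p) (G (p + 1) s) s) (J : List (Fin M)) :
    pdIter J (fun y => G 0 (‖y‖ ^ 2)) 0 = ∑ p ∈ Finset.range (J.length + 1),
      G p 0 / (p.factorial : ℝ) *
        pdIter J (fun z : EuclideanSpace ℝ (Fin M) => ‖z‖ ^ (2 * p)) 0 := by
  rw [radial_deriv G hG J]
  apply Finset.sum_congr rfl
  intro p hp
  rw [radQ_at_zero J p (by simp at hp; omega)]
  have : (p.factorial : ℝ) ≠ 0 := by positivity
  simp
  field_simp

lemma radial_odd {M : ℕ} (G : ℕ → ℝ → ℝ)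
    (hG : ∀ p s, 0 ≤ s → HasDerivAt (G p) (G (p + 1) s) s) (J : List (Fin M))
    (hJ : ∀ l, J.length ≠ 2 * l) : pdIter J (fun y => G 0 (‖y‖ ^ 2)) 0 = 0 := by
  rw [radial_at_zero G hG J]
  apply Finset.sum_eq_zero
  intro p _
  rw [normpow_zero p J (hJ p), mul_zero]

lemma radial_even {M : ℕ} (G : ℕ → ℝ → ℝ)
    (hG : ∀ p s, 0 ≤ s → HasDerivAt (G p) (G (p + 1) s) s) (J : List (Fin M)) (l : ℕ)
    (hJ : J.length = 2 * l) (y : EuclideanSpace ℝ (Fin M)) :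
    pdIter J (fun y => G 0 (‖y‖ ^ 2)) 0 = G l 0 / (l.factorial : ℝ) *
        pdIter J (fun z : EuclideanSpace ℝ (Fin M) => ‖z‖ ^ (2 * l)) y := by
  rw [radial_at_zero G hG J, ← normpow_const l J hJ y]
  apply Finset.sum_eq_single l
  · intro p _ hp
    rw [normpow_zero p J (by omega), mul_zero]
  · intro h; simp at h; omega

/-- embedding of the last coordinates -/
noncomputable def embL (M : ℕ) : EuclideanSpace ℝ (Fin M) →L[ℝ] EuclideanSpace ℝ (Fin (M + 1)) :=
  LinearMap.toContinuousLinearMap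
    { toFun := fun y => WithLp.toLp 2 (Fin.cons 0 y.ofLp)
      map_add' := by
        intro a b; ext i; refine Fin.cases ?_ (fun i => ?_) i <;> simp
      map_smul' := by
        intro a b; ext i; refine Fin.cases ?_ (fun i => ?_) i <;> simp }

lemma embL_zero {M : ℕ} (y : EuclideanSpace ℝ (Fin M)) : embL M y 0 = 0 := rfl

lemma embL_succ {M : ℕ} (y : EuclideanSpace ℝ (Fin M)) (j : Fin M) : embL M y j.succ = y j := rfl

lemma embL_single {M : ℕ} (j : Fin M) :
    embL M (EuclideanSpace.single j 1) = EuclideanSpace.single j.succ 1 := by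
  ext i
  refine Fin.cases ?_ (fun i => ?_) i
  · rw [embL_zero]; simp [Fin.succ_ne_zero, Ne.symm (Fin.succ_ne_zero j)]
  · rw [embL_succ]; simp [Pi.single_apply]

lemma norm_emb {M : ℕ} (t : ℝ) (y : EuclideanSpace ℝ (Fin M)) :
    ‖t • EuclideanSpace.single (0 : Fin (M + 1)) (1 : ℝ) + embL M y‖ ^ 2 = t ^ 2 + ‖y‖ ^ 2 := by
  rw [EuclideanSpace.norm_sq_eq, EuclideanSpace.norm_sq_eq, Fin.sum_univ_succ]
  simp [embL_zero, embL_succ, Fin.succ_ne_zero]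

lemma logn_smooth {N : ℕ} :
    ContDiffOn ℝ ∞ (fun z : EuclideanSpace ℝ (Fin N) => Real.log ‖z‖) {0}ᶜ := by
  intro x hx
  have hx' : x ≠ 0 := hx
  exact ((contDiffAt_norm ℝ hx').log (by simpa using hx')).contDiffWithinAt

lemma emb_ne {M : ℕ} {t : ℝ} (ht : 0 < t) (y : EuclideanSpace ℝ (Fin M)) :
    t • EuclideanSpace.single (0 : Fin (M + 1)) (1 : ℝ) + embL M y ∈
      ({0}ᶜ : Set (EuclideanSpace ℝ (Fin (M + 1)))) := by
  intro h
  have h1 := norm_emb t y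
  rw [Set.mem_singleton_iff.1 h] at h1
  have h2 : 0 < t ^ 2 + ‖y‖ ^ 2 := by positivity
  rw [← h1] at h2
  simp at h2

lemma restrict_deriv {M : ℕ} {u : EuclideanSpace ℝ (Fin (M + 1)) → ℝ}
    (hu : ContDiffOn ℝ ∞ u {0}ᶜ) {t : ℝ} (ht : 0 < t) (J : List (Fin M)) :
    ∀ y, pdIter (J.map Fin.succ) u (t • EuclideanSpace.single 0 1 + embL M y) =
      pdIter J (fun y => u (t • EuclideanSpace.single 0 1 + embL M y)) y := by
  induction J with
  | nil => intro y; rfl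
  | cons j J ih =>
    intro y
    rw [List.map_cons, pdIter_cons, pdIter_cons, ← funext ih]
    unfold pd
    have hd : DifferentiableAt ℝ (pdIter (J.map Fin.succ) u)
        (t • EuclideanSpace.single 0 1 + embL M y) :=
      ((pdIter_smooth isOpen_compl_singleton hu _).contDiffAt
        (isOpen_compl_singleton.mem_nhds (emb_ne ht y))).differentiableAt (by simp)
    have he : HasFDerivAt (fun y => t • EuclideanSpace.single (0 : Fin (M + 1)) (1 : ℝ) + embL M y)
      (embL M) y := (embL M).hasFDerivAt.const_add _
    have h := (hd.hasFDerivAt.comp y he).fderiv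
    have h' : fderiv ℝ (fun y => pdIter (J.map Fin.succ) u (t • EuclideanSpace.single 0 1 + embL M y)) y
      = _ := h
    rw [h']
    simp [embL_single]

noncomputable def logG (t : ℝ) : ℕ → ℝ → ℝ
  | 0 => fun s => Real.log (t ^ 2 + s) / 2
  | p + 1 => fun s => (-1) ^ p * (p.factorial : ℝ) / 2 * ((t ^ 2 + s) ^ (p + 1))⁻¹

lemma logG_deriv {t : ℝ} (ht : 0 < t) (p : ℕ) (s : ℝ) (hs : 0 ≤ s) :
    HasDerivAt (logG t p) (logG t (p + 1) s) s := by
  have h0 : t ^ 2 + s ≠ 0 := by positivity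
  have h1 : HasDerivAt (fun s => t ^ 2 + s) 1 s := (hasDerivAt_id s).const_add _
  cases p with
  | zero =>
    have := (h1.log h0).div_const 2
    convert! this using 1
    simp [logG]; ring
  | succ p =>
    have := ((h1.fun_pow (p + 1)).fun_inv (pow_ne_zero _ h0)).const_mul ((-1) ^ p * (p.factorial : ℝ) / 2)
    convert! this using 1
    simp only [logG, Nat.factorial_succ]
    push_cast
    field_simp
    ring

noncomputable def logK (l m : ℕ) (t : ℝ) : ℝ :=
  if m + 2 * l = 0 then Real.log t else
    (-1) ^ (m + l + 1) * ((m + 2 * l - 1).factorial : ℝ) / ((2 * l).factorial : ℝ) *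
      (t ^ (m + 2 * l))⁻¹

lemma logK_deriv (l m : ℕ) {t : ℝ} (ht : 0 < t) :
    HasDerivAt (logK l m) (logK l (m + 1) t) t := by
  unfold logK
  rcases Nat.eq_zero_or_pos (m + 2 * l) with h | h
  · have hm : m = 0 := by omega
    have hl : l = 0 := by omega
    subst hm; subst hl
    simpa using Real.hasDerivAt_log ht.ne'
  · obtain ⟨q, hq⟩ : ∃ q, m + 2 * l = q + 1 := ⟨m + 2 * l - 1, by omega⟩
    have e : m + 1 + 2 * l = q + 1 + 1 := by omega
    simp only [hq, e, Nat.add_sub_cancel, Nat.succ_ne_zero, if_false]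
    have := ((hasDerivAt_pow (q + 1) t).fun_inv (pow_ne_zero _ ht.ne')).const_mul
      ((-1) ^ (m + l + 1) * (q.factorial : ℝ) / ((2 * l).factorial : ℝ))
    convert! this using 1
    rw [Nat.factorial_succ]
    push_cast
    field_simp
    ring

lemma logG_logK (l : ℕ) {t : ℝ} (ht : 0 < t) : logG t l 0 / (l.factorial : ℝ) = logK l 0 t := by
  cases l with
  | zero => simp [logG, logK]
  | succ l =>
    have e : 0 + 2 * (l + 1) = 2 * l + 1 + 1 := by ring
    have e' : 2 * (l + 1) = 2 * l + 1 + 1 := by ring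
    have e4 : 2 * l + 1 + 1 - 1 = 2 * l + 1 := rfl
    rw [logK, if_neg (by omega), e, e', e4]
    simp only [logG]
    rw [Nat.factorial_succ (2 * l + 1), Nat.factorial_succ l]
    have e3 : (t ^ 2 + 0) ^ (l + 1) = t ^ (2 * l + 1 + 1) := by
      rw [add_zero, ← pow_mul]; rfl
    rw [e3]
    have h1 : ((2 * l + 1).factorial : ℝ) ≠ 0 := by positivity
    have h2 : (l.factorial : ℝ) ≠ 0 := by positivity
    have h3 : (l : ℝ) + 1 ≠ 0 := by positivity
    push_cast
    field_simp
    ring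

lemma base_fun {M : ℕ} {t : ℝ} (y : EuclideanSpace ℝ (Fin M)) :
    Real.log ‖t • EuclideanSpace.single (0 : Fin (M + 1)) (1 : ℝ) + embL M y‖ =
      logG t 0 (‖y‖ ^ 2) := by
  simp only [logG]
  rw [← norm_emb, Real.log_pow]
  push_cast; ring

lemma line_deriv {M : ℕ} {u : EuclideanSpace ℝ (Fin (M + 1)) → ℝ}
    (hu : ContDiffOn ℝ ∞ u {0}ᶜ) (L : List (Fin (M + 1))) (κ : ℕ → ℝ → ℝ)
    (hκ : ∀ m t, 0 < t → HasDerivAt (κ m) (κ (m + 1) t) t)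
    (h0 : ∀ t, 0 < t → pdIter L u (t • EuclideanSpace.single 0 1) = κ 0 t) (m : ℕ) :
    ∀ t, 0 < t → pdIter (List.replicate m 0 ++ L) u (t • EuclideanSpace.single 0 1) = κ m t := by
  induction m with
  | zero => simpa using h0
  | succ m ih =>
    intro t ht
    rw [List.replicate_succ, List.cons_append, pdIter_cons]
    have hne := emb_ne (M := M) ht 0
    rw [map_zero, add_zero] at hne
    have hd : DifferentiableAt ℝ (pdIter (List.replicate m 0 ++ L) u)
        (t • EuclideanSpace.single 0 1) :=
      ((pdIter_smooth isOpen_compl_singleton hu _).contDiffAt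
        (isOpen_compl_singleton.mem_nhds hne)).differentiableAt (by simp)
    have he : HasDerivAt (fun t : ℝ => t • EuclideanSpace.single (0 : Fin (M + 1)) (1 : ℝ))
        (EuclideanSpace.single (0 : Fin (M + 1)) (1 : ℝ)) t := by
      simpa using (hasDerivAt_id t).smul_const (EuclideanSpace.single (0 : Fin (M + 1)) (1 : ℝ))
    have h1 := hd.hasFDerivAt.comp_hasDerivAt t he
    have h2 : HasDerivAt (pdIter (List.replicate m 0 ++ L) u ∘
        fun t : ℝ => t • EuclideanSpace.single (0 : Fin (M + 1)) (1 : ℝ)) (κ (m + 1) t) t := by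
      refine (hκ m t ht).congr_of_eventuallyEq ?_
      filter_upwards [lt_mem_nhds ht] with s hs
      exact ih s hs
    exact h1.unique h2

lemma log_even {M : ℕ} (J : List (Fin M)) (l m : ℕ) (hJ : J.length = 2 * l)
    (y : EuclideanSpace ℝ (Fin M)) {t : ℝ} (ht : 0 < t) :
    pdIter (List.replicate m 0 ++ J.map Fin.succ) (fun z => Real.log ‖z‖)
      (t • EuclideanSpace.single 0 1) =
    logK l m t * pdIter J (fun z : EuclideanSpace ℝ (Fin M) => ‖z‖ ^ (2 * l)) y := by
  refine line_deriv logn_smooth _ (fun m t => logK l m t *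
    pdIter J (fun z : EuclideanSpace ℝ (Fin M) => ‖z‖ ^ (2 * l)) y) ?_ ?_ m t ht
  · intro m t ht
    exact (logK_deriv l m ht).mul_const _
  · intro t ht
    have h := restrict_deriv (M := M) logn_smooth ht J 0
    rw [map_zero, add_zero] at h
    rw [h]
    simp only [base_fun]
    rw [radial_even (logG t) (logG_deriv ht) J l hJ y, logG_logK l ht]

lemma log_odd {M : ℕ} (J : List (Fin M)) (m : ℕ) (hJ : ∀ l, J.length ≠ 2 * l)
    {t : ℝ} (ht : 0 < t) :
    pdIter (List.replicate m 0 ++ J.map Fin.succ) (fun z => Real.log ‖z‖)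
      (t • EuclideanSpace.single 0 1) = 0 := by
  refine line_deriv logn_smooth _ (fun m t => 0) ?_ ?_ m t ht
  · intro m t ht
    exact hasDerivAt_const _ _
  · intro t ht
    have h := restrict_deriv (M := M) logn_smooth ht J 0
    rw [map_zero, add_zero] at h
    rw [h]
    simp only [base_fun]
    rw [radial_odd (logG t) (logG_deriv ht) J hJ]

lemma sum_even (k : ℕ) (f : ℕ → ℝ) (hf : ∀ b, (∀ l, b ≠ 2 * l) → f b = 0) :
    ∑ b ∈ Finset.range (k + 1), f b = ∑ l ∈ Finset.range (k / 2 + 1), f (2 * l) := by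
  symm
  apply Finset.sum_of_injOn (fun l => 2 * l)
  · intro a _ b _ h; simpa using h
  · intro a ha; simp at ha ⊢; omega
  · intro b hb h
    apply hf
    intro l hl
    apply h
    simp at hb ⊢
    exact ⟨l, by omega, hl.symm⟩
  · intro l _; rfl

lemma coef_eq (k l : ℕ) (hk : 0 < k) (hl : 2 * l ≤ k) {t : ℝ} (ht : 0 < t) :
    t ^ (2 * k) * ((k.choose (k - 2 * l) : ℝ) * logK l (k - 2 * l) t ^ 2) =
    (k.factorial : ℝ) * (((k - 2 * l).factorial : ℝ) / ((2 * l).factorial : ℝ) *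
      ((-1) ^ (k + l) * (k.choose (2 * l) : ℝ) / k) ^ 2) := by
  have e : k - 2 * l + 2 * l = k := by omega
  rw [logK, e, if_neg (by omega), Nat.choose_symm hl, Nat.cast_choose ℝ hl]
  have hf : (k.factorial : ℝ) = k * ((k - 1).factorial : ℝ) := by
    rw [← Nat.mul_factorial_pred (by omega : k ≠ 0)]; push_cast; rfl
  have s1 : ∀ n : ℕ, ((-1 : ℝ) ^ n) ^ 2 = 1 := by intro n; rw [← pow_mul, mul_comm, pow_mul]; simp
  have h1 : (((2 * l).factorial : ℕ) : ℝ) ≠ 0 := by positivity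
  have h2 : (((k - 2 * l).factorial : ℕ) : ℝ) ≠ 0 := by positivity
  have h3 : (k : ℝ) ≠ 0 := by positivity
  rw [hf]
  simp only [mul_pow, div_pow, s1, inv_pow]
  rw [← pow_mul, mul_comm k 2]
  field_simp

lemma sum_anti (k : ℕ) (f : ℕ → ℕ → ℝ) :
    ∑ p ∈ Finset.HasAntidiagonal.antidiagonal k, f p.1 p.2 =
      ∑ b ∈ Finset.range (k + 1), f (k - b) b := by
  rw [← Finset.Nat.sum_antidiagonal_swap]
  exact Finset.Nat.sum_antidiagonal_eq_sum_range_succ_mk (fun p => f p.2 p.1) k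

theorem stmt_13 (N k : ℕ) (hN : 2 ≤ N) (hk : 0 < k)
    (x : EuclideanSpace ℝ (Fin N)) (hx : x ≠ 0)
    (y : EuclideanSpace ℝ (Fin (N - 1))) (hy : y ≠ 0) :
    ‖x‖ ^ (2 * k) * gradSq N k (fun z => Real.log ‖z‖) x =
      (Nat.factorial k : ℝ) *
        ∑ l ∈ Finset.range (k / 2 + 1),
          ((Nat.factorial (k - 2 * l) : ℝ) / (Nat.factorial (2 * l) : ℝ)) *
            (∑ n ∈ Finset.Icc ((k + 1) / 2) (k - l),
              (2 : ℝ) ^ (2 * n - k) * ((-1 : ℝ) ^ n / (2 * n)) * gchoose (n : ℝ) (k - n) *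
                gchoose ((k - n : ℕ) : ℝ) l) ^ 2 *
            gradSq (N - 1) (2 * l) (fun z => ‖z‖ ^ (2 * l)) y := by
  obtain ⟨M, rfl⟩ : ∃ M, N = M + 1 := ⟨N - 1, by omega⟩
  change EuclideanSpace ℝ (Fin M) at y
  have e0 : M + 1 - 1 = M := rfl
  simp only [e0, coef_sum k _ hk]
  obtain ⟨A, hA⟩ := exists_rot x hx
  have ht : 0 < ‖x‖ := norm_pos_iff.2 hx
  set t := ‖x‖ with htdef
  have hne := emb_ne (M := M) ht 0
  rw [map_zero, add_zero] at hne
  have hrot := gradSq_rot k logn_smooth A (fun z => by simp) _ hne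
  rw [hA] at hrot
  rw [hrot]
  have hdec := perm_decomp (M := M) k (fun L => pdIter L (fun z => Real.log ‖z‖)
    (t • EuclideanSpace.single 0 1))
    (fun l l' h => pdIter_perm isOpen_compl_singleton logn_smooth h hne)
  unfold gradSq
  rw [hdec, sum_anti k (fun m b => (k.choose m : ℝ) *
      ∑ j : Fin b → Fin M, (pdIter (List.replicate m 0 ++ (List.ofFn j).map Fin.succ)
        (fun z => Real.log ‖z‖) (t • EuclideanSpace.single 0 1)) ^ 2)]
  rw [sum_even k (fun b => (k.choose (k - b) : ℝ) *
      ∑ j : Fin b → Fin M, (pdIter (List.replicate (k - b) 0 ++ (List.ofFn j).map Fin.succ)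
        (fun z => Real.log ‖z‖) (t • EuclideanSpace.single 0 1)) ^ 2)]
  · rw [Finset.mul_sum, Finset.mul_sum]
    apply Finset.sum_congr rfl
    intro l hl
    simp only [Finset.mem_range] at hl
    have hj : ∀ j : Fin (2 * l) → Fin M, _ := fun j =>
      log_even (List.ofFn j) l (k - 2 * l) (by simp) y ht
    simp only [hj, mul_pow]
    rw [← Finset.mul_sum]
    have := coef_eq k l hk (by omega) ht
    rw [← mul_assoc, ← mul_assoc, mul_assoc (t ^ (2 * k)), this]
    simp only [mul_assoc]
    rfl
  · intro b hb
    rw [Finset.sum_eq_zero, mul_zero]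
    intro j _
    rw [log_odd (List.ofFn j) (k - b) (by simpa using hb) ht]
    simp
end

section
/- Let N be a positive integer and let m be a nonnegative integer. Then for every x ∈ ℝ^N \ {0}, |∇_N^{2m} p_m(x)|² = 2^{2m} · m! · (2m)! · (N/2 + m − 1)_m, where p_m(x) = |x|^{2m}. -/
open scoped BigOperators

open MvPolynomial in
theorem aux_eval {N : ℕ} (P : MvPolynomial (Fin N) ℝ) :
    Differentiable ℝ (fun y : EuclideanSpace ℝ (Fin N) => eval (fun j => y j) P) ∧
    ∀ (i : Fin N), pd i (fun y : EuclideanSpace ℝ (Fin N) => eval (fun j => y j) P) =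
      fun y => eval (fun j => y j) (pderiv i P) := by
  induction P using MvPolynomial.induction_on with
  | C a =>
    refine ⟨by simp, fun i => ?_⟩
    funext x
    simp [pd]
  | add p q hp hq =>
    refine ⟨by simp only [map_add]; exact hp.1.add hq.1, fun i => ?_⟩
    funext x
    have h1 := congrFun (hp.2 i) x
    have h2 := congrFun (hq.2 i) x
    simp only [pd] at h1 h2
    simp only [pd, map_add]
    rw [fderiv_fun_add (hp.1 x) (hq.1 x)]
    simp [h1, h2]
  | mul_X p j hp =>
    have hX : ∀ x : EuclideanSpace ℝ (Fin N), HasFDerivAt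
        (fun y : EuclideanSpace ℝ (Fin N) => y j) (EuclideanSpace.proj j : _ →L[ℝ] ℝ) x :=
      fun x => (EuclideanSpace.proj j : EuclideanSpace ℝ (Fin N) →L[ℝ] ℝ).hasFDerivAt
    refine ⟨?_, fun i => ?_⟩
    · simp only [map_mul, eval_X]
      exact hp.1.mul (fun x => (hX x).differentiableAt)
    funext x
    have h1 := congrFun (hp.2 i) x
    simp only [pd] at h1
    simp only [pd, map_mul, eval_X]
    rw [fderiv_fun_mul (hp.1 x) (hX x).differentiableAt, (hX x).fderiv]
    simp [h1, Derivation.leibniz, pderiv_X, Pi.single_apply, eq_comm]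
    split_ifs <;> simp

open MvPolynomial in
theorem aux_comm {N : ℕ} (i j : Fin N) (P : MvPolynomial (Fin N) ℝ) :
    pderiv i (pderiv j P) = pderiv j (pderiv i P) := by
  induction P using MvPolynomial.induction_on with
  | C a => simp
  | add p q hp hq => simp [hp, hq]
  | mul_X p k hp =>
    have h : ∀ a b : Fin N, pderiv a (pderiv b (X k : MvPolynomial (Fin N) ℝ)) = 0 := by
      intro a b
      rw [pderiv_X, Pi.single_apply]
      split_ifs <;> simp
    simp only [Derivation.leibniz, map_add, hp, smul_eq_mul, h]
    ring

open MvPolynomial in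
/-- The bilinear form `Σ_{|i|=k} D_i P D_i Q`, as a polynomial. -/
noncomputable def SS {N : ℕ} : ℕ → MvPolynomial (Fin N) ℝ → MvPolynomial (Fin N) ℝ →
    MvPolynomial (Fin N) ℝ
  | 0, P, Q => P * Q
  | k + 1, P, Q => ∑ l, SS k (pderiv l P) (pderiv l Q)

open MvPolynomial in
theorem SS_add_left {N : ℕ} (k : ℕ) : ∀ (P P' Q : MvPolynomial (Fin N) ℝ),
    SS k (P + P') Q = SS k P Q + SS k P' Q := by
  induction k with
  | zero => intro P P' Q; simp [SS, add_mul]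
  | succ k ih => intro P P' Q; simp [SS, ih, Finset.sum_add_distrib]

open MvPolynomial in
theorem SS_add_right {N : ℕ} (k : ℕ) : ∀ (P Q Q' : MvPolynomial (Fin N) ℝ),
    SS k P (Q + Q') = SS k P Q + SS k P Q' := by
  induction k with
  | zero => intro P P' Q; simp [SS, mul_add]
  | succ k ih => intro P P' Q; simp [SS, ih, Finset.sum_add_distrib]

open MvPolynomial in
theorem SS_zero_left {N : ℕ} (k : ℕ) (Q : MvPolynomial (Fin N) ℝ) : SS k 0 Q = 0 := by
  have := SS_add_left k 0 0 Q
  simpa using this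

open MvPolynomial in
theorem SS_zero_right {N : ℕ} (k : ℕ) (Q : MvPolynomial (Fin N) ℝ) : SS k Q 0 = 0 := by
  have := SS_add_right k Q 0 0
  simpa using this

open MvPolynomial in
theorem SS_C_right {N : ℕ} (k : ℕ) (c : ℝ) : ∀ (P Q : MvPolynomial (Fin N) ℝ),
    SS k P (C c * Q) = C c * SS k P Q := by
  induction k with
  | zero => intro P Q; simp only [SS]; ring
  | succ k ih => intro P Q; simp [SS, ih, Finset.mul_sum, Derivation.leibniz]

theorem SS_sum_left {N : ℕ} (k : ℕ) (f : Fin N → MvPolynomial (Fin N) ℝ)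
    (Q : MvPolynomial (Fin N) ℝ) (s : Finset (Fin N)) :
    SS k (∑ j ∈ s, f j) Q = ∑ j ∈ s, SS k (f j) Q := by
  induction s using Finset.induction_on with
  | empty => simp [SS_zero_left]
  | insert a s ha ih => rw [Finset.sum_insert ha, Finset.sum_insert ha, SS_add_left, ih]

theorem SS_sum_right {N : ℕ} (k : ℕ) (f : Fin N → MvPolynomial (Fin N) ℝ)
    (Q : MvPolynomial (Fin N) ℝ) (s : Finset (Fin N)) :
    SS k Q (∑ j ∈ s, f j) = ∑ j ∈ s, SS k Q (f j) := by
  induction s using Finset.induction_on with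
  | empty => simp [SS_zero_right]
  | insert a s ha ih => rw [Finset.sum_insert ha, Finset.sum_insert ha, SS_add_right, ih]

open MvPolynomial in
theorem SS_split {N : ℕ} (k : ℕ) (j : Fin N) (P Q : MvPolynomial (Fin N) ℝ) :
    SS (k + 1) (X j * P) Q = SS k P (pderiv j Q) + ∑ l, SS k (X j * pderiv l P) (pderiv l Q) := by
  simp only [SS, Derivation.leibniz, smul_eq_mul, SS_add_left, Finset.sum_add_distrib]
  rw [add_comm]
  congr 1
  rw [Finset.sum_eq_single j]
  · simp
  · intro b _ hb
    rw [pderiv_X_of_ne hb.symm, mul_zero, SS_zero_left]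
  · simp

open MvPolynomial in
theorem SS_adj {N : ℕ} (k : ℕ) : ∀ (j : Fin N) (P Q : MvPolynomial (Fin N) ℝ),
    P.IsHomogeneous k → SS (k + 1) (X j * P) Q = ((k : MvPolynomial (Fin N) ℝ) + 1) *
      SS k P (pderiv j Q) := by
  induction k with
  | zero =>
    intro j P Q hP
    rw [SS_split]
    have : ∀ l, pderiv l P = 0 := by
      intro l
      rw [← totalDegree_zero_iff_isHomogeneous] at hP
      rw [totalDegree_eq_zero_iff_eq_C] at hP
      rw [hP]; simp
    simp [this, SS_zero_left]
  | succ k ih =>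
    intro j P Q hP
    rw [SS_split]
    have : ∀ l, SS (k + 1) (X j * pderiv l P) (pderiv l Q) =
        ((k : MvPolynomial (Fin N) ℝ) + 1) * SS k (pderiv l P) (pderiv l (pderiv j Q)) := by
      intro l
      rw [ih j _ _ (by simpa using hP.pderiv (i := l)), aux_comm]
    simp only [this, ← Finset.mul_sum]
    simp only [SS]
    push_cast
    ring

open MvPolynomial in
/-- `|x|²` as a polynomial. -/
noncomputable def rr (N : ℕ) : MvPolynomial (Fin N) ℝ := ∑ j, X j * X j

open MvPolynomial in
theorem rr_hom (N m : ℕ) : (rr N ^ m).IsHomogeneous (2 * m) := by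
  apply IsHomogeneous.pow
  apply IsHomogeneous.sum
  intro i _
  exact (isHomogeneous_X ℝ i).mul (isHomogeneous_X ℝ i)

open MvPolynomial in
theorem pderiv_rr (N : ℕ) (j : Fin N) : pderiv j (rr N) = 2 * X j := by
  simp only [rr, map_sum, Derivation.leibniz, smul_eq_mul]
  rw [Finset.sum_eq_single j]
  · simp; ring
  · intro b _ hb
    rw [pderiv_X_of_ne hb]; simp
  · simp

open MvPolynomial in
theorem lap_rr (N m : ℕ) : ∑ j, pderiv j (pderiv j (rr N ^ (m + 1))) =
    C ((2 * m + 2) * (2 * m + N) : ℝ) * rr N ^ m := by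
  have h : ∀ j : Fin N, pderiv j (pderiv j (rr N ^ (m + 1))) =
      (2 * (m + 1) : MvPolynomial (Fin N) ℝ) * rr N ^ m +
      ((4 * (m + 1) * m : MvPolynomial (Fin N) ℝ) * rr N ^ (m - 1)) * (X j * X j) := by
    intro j
    simp only [Derivation.leibniz_pow, pderiv_rr, Derivation.leibniz, smul_eq_mul, nsmul_eq_mul,
      Nat.add_sub_cancel, Derivation.map_natCast, pderiv_X_self]
    have h2 : pderiv j (2 : MvPolynomial (Fin N) ℝ) = 0 :=
      Derivation.map_natCast (pderiv j) 2
    rw [h2]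
    push_cast
    ring
  simp only [h, Finset.sum_add_distrib, ← Finset.mul_sum]
  have : ∑ j, X j * X j = rr N := rfl
  rw [this]
  have hC : (C 2 : MvPolynomial (Fin N) ℝ) = 2 := map_ofNat C 2
  rcases m with _ | m
  · simp [hC] <;> ring
  · simp [pow_succ, hC]
    ring

open MvPolynomial in
theorem SS_main (N m : ℕ) : SS (2 * m) (rr N ^ m) (rr N ^ m) =
    C (2 ^ (2 * m) * (Nat.factorial m : ℝ) * (Nat.factorial (2 * m) : ℝ) *
        ffac ((N : ℝ) / 2 + m - 1) m) := by
  induction m with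
  | zero => simp [SS, ffac]
  | succ m ih =>
    have h1 : rr N ^ (m + 1) = ∑ j, X j * (X j * rr N ^ m) := by
      rw [pow_succ', rr, Finset.sum_mul]
      simp only [mul_assoc]
    have h2 : ∀ Q, SS (2 * m + 1 + 1) (rr N ^ (m + 1)) Q =
        C ((2 * m + 1 + 1) * (2 * m + 1) : ℝ) *
          SS (2 * m) (rr N ^ m) (∑ j, pderiv j (pderiv j Q)) := by
      intro Q
      rw [h1, SS_sum_left, SS_sum_right, Finset.mul_sum]
      refine Finset.sum_congr rfl fun j _ => ?_
      rw [SS_adj (2 * m + 1) j, SS_adj (2 * m) j _ _ (rr_hom N m)]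
      · have hC : (C 2 : MvPolynomial (Fin N) ℝ) = 2 := map_ofNat C 2
        simp [hC]; ring
      · rw [add_comm]; exact (isHomogeneous_X ℝ j).mul (rr_hom N m)
    rw [show 2 * (m + 1) = 2 * m + 1 + 1 by ring, h2, lap_rr, SS_C_right, ih, ← C_mul, ← C_mul]
    congr 1
    have h3 : ffac ((N : ℝ) / 2 + (m + 1 : ℕ) - 1) (m + 1) =
        (N / 2 + m) * ffac ((N : ℝ) / 2 + m - 1) m := by
      unfold ffac
      rw [Finset.prod_range_succ', mul_comm]
      congr 1
      · push_cast; ring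
      · refine Finset.prod_congr rfl fun i _ => ?_
        push_cast; ring
    rw [h3, Nat.factorial_succ, Nat.factorial_succ (2 * m + 1), Nat.factorial_succ (2 * m)]
    push_cast
    ring

open MvPolynomial in
theorem aux_iter {N : ℕ} (l : List (Fin N)) (P : MvPolynomial (Fin N) ℝ) :
    pdIter l (fun y : EuclideanSpace ℝ (Fin N) => eval (fun j => y j) P) =
      fun y => eval (fun j => y j) (l.foldr (fun i p => pderiv i p) P) := by
  induction l with
  | nil => rfl
  | cons a l ih =>
    unfold pdIter at ih ⊢
    rw [List.foldr_cons, ih, (aux_eval _).2]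
    rfl

open MvPolynomial in
theorem aux_foldr {N : ℕ} (l : List (Fin N)) (a : Fin N) (P : MvPolynomial (Fin N) ℝ) :
    pderiv a (l.foldr (fun i p => pderiv i p) P) =
      l.foldr (fun i p => pderiv i p) (pderiv a P) := by
  induction l with
  | nil => rfl
  | cons b l ih => rw [List.foldr_cons, List.foldr_cons, ← ih, aux_comm]

open MvPolynomial in
theorem SS_eq {N : ℕ} (k : ℕ) : ∀ (P : MvPolynomial (Fin N) ℝ),
    SS k P P = ∑ i : Fin k → Fin N, ((List.ofFn i).foldr (fun i p => pderiv i p) P) ^ 2 := by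
  induction k with
  | zero => intro P; simp [SS, sq]
  | succ k ih =>
    intro P
    rw [← (Fin.consEquiv (fun _ : Fin (k + 1) => Fin N)).sum_comp, Fintype.sum_prod_type]
    simp only [SS, ih]
    refine Finset.sum_congr rfl fun a _ => Finset.sum_congr rfl fun i _ => ?_
    simp [Fin.consEquiv, List.ofFn_succ, aux_foldr]

theorem stmt_14 (N : ℕ) (hN : 0 < N) (m : ℕ)
    (x : EuclideanSpace ℝ (Fin N)) (hx : x ≠ 0) :
    gradSq N (2 * m) (fun y => ‖y‖ ^ (2 * m)) x =
      2 ^ (2 * m) * (Nat.factorial m : ℝ) * (Nat.factorial (2 * m) : ℝ) *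
        ffac ((N : ℝ) / 2 + m - 1) m := by
  have h : (fun y : EuclideanSpace ℝ (Fin N) => ‖y‖ ^ (2 * m)) =
      fun y => MvPolynomial.eval (fun j => y j) (rr N ^ m) := by
    funext y
    rw [pow_mul, EuclideanSpace.norm_sq_eq]
    simp [rr, sq]
  have h2 := congrArg (MvPolynomial.eval (fun j => x j)) (SS_main N m)
  rw [MvPolynomial.eval_C, SS_eq, map_sum] at h2
  rw [← h2, h]
  unfold gradSq
  refine Finset.sum_congr rfl fun i _ => ?_
  rw [aux_iter, map_pow]
end

section
/- Let m and k be nonnegative integers and let φ^m : ℝ → ℝ be defined by φ^m(t) = (t² + 2t)^m. Then the k-th derivative of φ^m at 0 equals 2^{2m−k} · k! · C(m, k−m) if m ≤ k ≤ 2m, and equals 0 otherwise. -/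
lemma iter_poly (p : Polynomial ℝ) (k : ℕ) :
    iteratedDeriv k (fun t : ℝ => p.eval t) =
      fun t => ((Polynomial.derivative^[k]) p).eval t := by
  induction k with
  | zero => simp
  | succ k ih =>
    rw [iteratedDeriv_succ, ih]
    funext t
    rw [Polynomial.deriv, Function.iterate_succ_apply']

theorem stmt_15 (m k : ℕ) :
    iteratedDeriv k (fun t : ℝ => (t ^ 2 + 2 * t) ^ m) 0 =
      if m ≤ k ∧ k ≤ 2 * m then
        (2 : ℝ) ^ (2 * m - k) * (Nat.factorial k : ℝ) * (Nat.choose m (k - m) : ℝ)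
      else 0 := by
  have h : (fun t : ℝ => (t ^ 2 + 2 * t) ^ m) = fun t =>
      ((Polynomial.X ^ m * (Polynomial.X + Polynomial.C 2) ^ m : Polynomial ℝ)).eval t := by
    funext t
    simp only [Polynomial.eval_mul, Polynomial.eval_pow, Polynomial.eval_add,
      Polynomial.eval_X, Polynomial.eval_C]
    rw [← mul_pow]
    ring
  rw [h, iter_poly]
  simp only []
  rw [← Polynomial.coeff_zero_eq_eval_zero, Polynomial.coeff_iterate_derivative, zero_add,
    Nat.descFactorial_self, Polynomial.coeff_X_pow_mul', Polynomial.coeff_X_add_C_pow,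
    nsmul_eq_mul]
  by_cases h1 : m ≤ k
  · by_cases h2 : k ≤ 2 * m
    · have h3 : m - (k - m) = 2 * m - k := by omega
      rw [if_pos h1, if_pos ⟨h1, h2⟩, h3]
      ring
    · rw [if_pos h1, if_neg (fun h => h2 h.2), Nat.choose_eq_zero_of_lt (by omega)]
      simp
  · rw [if_neg h1, if_neg (fun h => h1 h.1), mul_zero]
end

section
/- Let ε > 0, let (a_n)_{n≥0} be real numbers such that the power series f(t) = Σ_{n=0}^{∞} a_n t^n converges for −ε < t < ε, and let ρ_1(x) = x² + 2x. Then for every nonnegative integer k, the k-th derivative of f ∘ ρ_1 at 0 equals k! · Σ_{n=⌈k/2⌉}^{k} 2^{2n−k} · a_n · C(n, k−n). -/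
theorem aux_poly (p : Polynomial ℝ) (k : ℕ) :
    iteratedDeriv k (fun x : ℝ => p.eval x) 0 = (Nat.factorial k : ℝ) * p.coeff k := by
  have h : ∀ k : ℕ, iteratedDeriv k (fun x : ℝ => p.eval x)
      = fun x => (Polynomial.derivative^[k] p).eval x := by
    intro k
    induction k with
    | zero => simp
    | succ k ih =>
      rw [iteratedDeriv_succ, ih]
      funext x
      rw [Polynomial.deriv, Function.iterate_succ_apply']
  rw [h]
  simp only
  rw [← Polynomial.coeff_zero_eq_eval_zero, Polynomial.coeff_iterate_derivative]
  simp [Nat.descFactorial_self]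

theorem aux_coeff (n k : ℕ) (h : n ≤ k) :
    ((Polynomial.X ^ 2 + 2 * Polynomial.X : Polynomial ℝ) ^ n).coeff k
      = 2 ^ (n - (k - n)) * (Nat.choose n (k - n) : ℝ) := by
  have e : (Polynomial.X ^ 2 + 2 * Polynomial.X : Polynomial ℝ) ^ n
      = (Polynomial.X + Polynomial.C 2) ^ n * Polynomial.X ^ n := by
    rw [← mul_pow, show (Polynomial.C (2 : ℝ)) = 2 from rfl]
    ring
  obtain ⟨d, rfl⟩ := Nat.exists_eq_add_of_le' h
  rw [e, Polynomial.coeff_mul_X_pow, Polynomial.coeff_X_add_C_pow]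
  simp

theorem aux_tail (ε : ℝ) (hε : 0 < ε) (a : ℕ → ℝ) (f : ℝ → ℝ)
    (hf : ∀ t : ℝ, -ε < t → t < ε → HasSum (fun n => a n * t ^ n) (f t)) (m : ℕ) :
    ∃ g : ℝ → ℝ, AnalyticAt ℝ g 0 ∧ ∀ t : ℝ, -ε < t → t < ε →
      f t = (∑ n ∈ Finset.range m, a n * t ^ n) + t ^ m * g t := by
  have hs : ∀ t : ℝ, -ε < t → t < ε → Summable (fun n => a (n + m) * t ^ n) := by
    intro t h1 h2
    by_cases ht : t = 0
    · subst ht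
      refine summable_of_ne_finset_zero (s := {0}) ?_
      intro b hb
      simp at hb
      simp [hb]
    · have := ((summable_nat_add_iff m).2 (hf t h1 h2).summable).mul_right ((t ^ m)⁻¹)
      refine this.congr ?_
      intro n
      rw [pow_add]
      field_simp
  refine ⟨fun t => ∑' n, a (n + m) * t ^ n, ?_, ?_⟩
  · refine ⟨FormalMultilinearSeries.ofScalars ℝ (fun n => a (n + m)), ?_⟩
    rw [hasFPowerSeriesAt_iff]
    filter_upwards [Ioo_mem_nhds (neg_lt_zero.2 hε) hε] with t ht
    simp only [FormalMultilinearSeries.coeff_ofScalars, smul_eq_mul, zero_add, mul_comm (t ^ _)]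
    exact (hs t ht.1 ht.2).hasSum
  · intro t h1 h2
    rw [← (hf t h1 h2).tsum_eq, ← (hf t h1 h2).summable.sum_add_tsum_nat_add m, ← tsum_mul_left]
    congr 2
    funext n
    ring

theorem stmt_17 (ε : ℝ) (hε : 0 < ε) (a : ℕ → ℝ) (f : ℝ → ℝ)
    (hf : ∀ t : ℝ, -ε < t → t < ε → HasSum (fun n => a n * t ^ n) (f t)) (k : ℕ) :
    iteratedDeriv k (fun x : ℝ => f (x ^ 2 + 2 * x)) 0 =
      (Nat.factorial k : ℝ) *
        ∑ n ∈ Finset.Icc ((k + 1) / 2) k,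
          (2 : ℝ) ^ (2 * n - k) * a n * (Nat.choose n (k - n) : ℝ) := by
  obtain ⟨g, hg, hfg⟩ := aux_tail ε hε a f hf (k + 1)
  let P : Polynomial ℝ := ∑ n ∈ Finset.range (k + 1),
    Polynomial.C (a n) * (Polynomial.X ^ 2 + 2 * Polynomial.X) ^ n
  let h : ℝ → ℝ := fun x => (x + 2) ^ (k + 1) * g (x ^ 2 + 2 * x)
  have hh : AnalyticAt ℝ h 0 := by
    have h0 : AnalyticAt ℝ (fun x : ℝ => x ^ 2 + 2 * x) 0 := by fun_prop
    have h1 : AnalyticAt ℝ (fun x : ℝ => g (x ^ 2 + 2 * x)) 0 :=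
      AnalyticAt.fun_comp (g := g) (by simpa using hg) h0
    have h2 : AnalyticAt ℝ (fun x : ℝ => (x + 2) ^ (k + 1)) 0 := by fun_prop
    exact h2.mul h1
  have hE : (fun x : ℝ => f (x ^ 2 + 2 * x)) =ᶠ[nhds 0]
      (fun x : ℝ => P.eval x) + ((fun x : ℝ => x ^ (k + 1)) * h) := by
    have hc : ContinuousAt (fun x : ℝ => x ^ 2 + 2 * x) 0 := by fun_prop
    have hm := hc.preimage_mem_nhds (t := Set.Ioo (-ε) ε)
      (by simpa using Ioo_mem_nhds (neg_lt_zero.2 hε) hε)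
    filter_upwards [hm] with x hx
    rw [hfg _ hx.1 hx.2]
    simp only [Pi.add_apply, Pi.mul_apply, P, h, Polynomial.eval_finsetSum]
    congr 1
    · simp
    · rw [← mul_assoc, ← mul_pow]
      ring
  have hP : ContDiffAt ℝ k (fun x : ℝ => P.eval x) 0 := by
    simpa using (P.contDiff_aeval (𝕜 := ℝ) k).contDiffAt (x := (0 : ℝ))
  have hk : ContDiffAt ℝ k h 0 := hh.contDiffAt
  have hp : ContDiffAt ℝ k (fun x : ℝ => x ^ (k + 1)) 0 := by fun_prop
  rw [hE.iteratedDeriv_eq k, iteratedDeriv_add hP (g := (fun x : ℝ => x ^ (k + 1)) * h) (hp.mul hk),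
    aux_poly, iteratedDeriv_mul hp hk, Finset.sum_eq_zero, add_zero]
  · congr 1
    simp only [P, Polynomial.finset_sum_coeff, Polynomial.coeff_C_mul]
    symm
    have hsub : Finset.Icc ((k + 1) / 2) k ⊆ Finset.range (k + 1) := by
      intro n hn
      simp at hn ⊢
      omega
    rw [← Finset.sum_subset hsub]
    · refine Finset.sum_congr rfl ?_
      intro n hn
      simp at hn
      rw [aux_coeff n k (by omega), show n - (k - n) = 2 * n - k by omega]
      ring
    · intro n hn hn'
      simp at hn hn'
      rw [aux_coeff n k (by omega), Nat.choose_eq_zero_of_lt (by omega)]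
      simp
  · intro i hi
    simp at hi
    rw [iteratedDeriv_fun_pow_zero, if_neg (by omega)]
    simp
end

section
/- Let ν be a real number and let m be a nonnegative integer. Then Σ_{l=0}^{m} ((2l)! / (2^{2l} · l!)) · (ν + m − l)_{m−l} · C(m, l) = (ν + m + 1/2)_m. -/
/-- Rising factorial. -/
noncomputable def rfac (a : ℝ) (k : ℕ) : ℝ := ∏ j ∈ Finset.range k, (a + j)

theorem rfac_succ (a : ℝ) (k : ℕ) : rfac a (k + 1) = rfac a k * (a + k) := by
  simp [rfac, Finset.prod_range_succ]

theorem rfac_vandermonde (a b : ℝ) (m : ℕ) :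
    ∑ p ∈ Finset.HasAntidiagonal.antidiagonal m, (m.choose p.1 : ℝ) * (rfac a p.1 * rfac b p.2) =
      rfac (a + b) m := by
  induction m with
  | zero => simp [rfac]
  | succ m ih =>
    have h := Finset.sum_antidiagonal_choose_succ_mul (fun i j => rfac a i * rfac b j) m
    rw [h, rfac_succ, ← ih, Finset.sum_mul, ← Finset.sum_add_distrib]
    refine Finset.sum_congr rfl fun p hp => ?_
    have hm : p.1 + p.2 = m := Finset.HasAntidiagonal.mem_antidiagonal.mp hp
    have hs : m.choose p.2 = m.choose p.1 := by
      rw [← hm, Nat.choose_symm_add]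
    rw [rfac_succ, rfac_succ, hs]
    have hc : (m : ℝ) = p.1 + p.2 := by exact_mod_cast hm.symm
    rw [hc]
    ring

theorem ffac_eq_rfac (ν : ℝ) (k : ℕ) : ffac (ν + k) k = rfac (ν + 1) k := by
  unfold ffac rfac
  rw [← Finset.prod_range_reflect]
  refine Finset.prod_congr rfl fun j hj => ?_
  have hj' := Finset.mem_range.mp hj
  rw [Nat.cast_sub (by omega), Nat.cast_sub (by omega)]
  push_cast
  ring

theorem rfac_half (l : ℕ) :
    (Nat.factorial (2 * l) : ℝ) / (2 ^ (2 * l) * (Nat.factorial l : ℝ)) = rfac (1 / 2) l := by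
  induction l with
  | zero => simp [rfac]
  | succ l ih =>
    rw [rfac_succ, ← ih, show 2 * (l + 1) = 2 * l + 1 + 1 by ring, Nat.factorial_succ,
      Nat.factorial_succ, Nat.factorial_succ]
    have := Nat.factorial_ne_zero l
    push_cast
    field_simp
    ring

theorem stmt_18 (ν : ℝ) (m : ℕ) :
    ∑ l ∈ Finset.range (m + 1),
      ((Nat.factorial (2 * l) : ℝ) / (2 ^ (2 * l) * (Nat.factorial l : ℝ))) *
        ffac (ν + m - l) (m - l) * (Nat.choose m l : ℝ) =
      ffac (ν + m + 1 / 2) m := by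
  have h := rfac_vandermonde (1 / 2) (ν + 1) m
  rw [Finset.Nat.sum_antidiagonal_eq_sum_range_succ_mk] at h
  rw [show ν + m + 1 / 2 = (ν + 1 / 2) + m by ring, ffac_eq_rfac,
    show ν + 1 / 2 + 1 = 1 / 2 + (ν + 1) by ring, ← h]
  refine Finset.sum_congr rfl fun l hl => ?_
  have hl' := Finset.mem_range.mp hl
  rw [rfac_half, show ν + m - l = ν + ((m - l : ℕ) : ℝ) by
    rw [Nat.cast_sub (by omega)]; ring, ffac_eq_rfac]
  ring
end
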